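/- Assume p > q > 1, λ > 0, that p and q satisfy (N+α)/N < p < (N+α)/(N−2s) and (N+β)/N < q < (N+β)/(N−2s), that V satisfies (V1), and that m_J is attained, i.e. there exists Q ∈ N_J with J(Q) = m_J (a groundstate of the unperturbed problem). Then m_λ < m_J, where m_λ = inf_{u ∈ N_λ} E_λ(u) and m_J = inf_{u ∈ N_J} J(u). -/

import Mathlib

open MeasureTheory Real Filter Topology

noncomputable section

abbrev Sp (N : ℕ) := EuclideanSpace ℝ (Fin N)

/-- Square of the Gagliardo seminorm `[u]²`. -/
noncomputable def gagSq (N : ℕ) (s : ℝ) (u : Sp N → ℝ) : ℝ :=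
  ∫ z : Sp N × Sp N, (u z.1 - u z.2) ^ 2 * ‖z.1 - z.2‖ ^ (-(N : ℝ) - 2 * s)

/-- Membership in the space `X = X_V^s(ℝ^N)`. -/
def memX (N : ℕ) (s : ℝ) (V : Sp N → ℝ) (u : Sp N → ℝ) : Prop :=
  Measurable u ∧
  Integrable (fun z : Sp N × Sp N => (u z.1 - u z.2) ^ 2 * ‖z.1 - z.2‖ ^ (-(N : ℝ) - 2 * s)) ∧
  Integrable (fun x => V x * u x ^ 2)

/-- Square of the norm on `X`: `‖u‖² = [u]² + ∫ V u²`. -/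
noncomputable def normSq (N : ℕ) (s : ℝ) (V : Sp N → ℝ) (u : Sp N → ℝ) : ℝ :=
  gagSq N s u + ∫ x, V x * u x ^ 2

/-- The nonlocal term `D_{γ,m}(u) = ∬ |u(x)|^m |u(y)|^m |x-y|^{γ-N}`. -/
noncomputable def Dnl (N : ℕ) (γ m : ℝ) (u : Sp N → ℝ) : ℝ :=
  ∫ z : Sp N × Sp N, |u z.1| ^ m * |u z.2| ^ m * ‖z.1 - z.2‖ ^ (γ - (N : ℝ))

/-- The energy functional `E_λ`. -/
noncomputable def energy (N : ℕ) (s α β p q lam : ℝ) (V : Sp N → ℝ) (u : Sp N → ℝ) : ℝ :=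
  normSq N s V u / 2 - Dnl N α p u / (2 * p) - lam * Dnl N β q u / (2 * q)

/-- The derivative pairing `E'_λ(u)[v]`. -/
noncomputable def pairing (N : ℕ) (s α β p q lam : ℝ) (V : Sp N → ℝ) (u v : Sp N → ℝ) : ℝ :=
  (∫ z : Sp N × Sp N, (u z.1 - u z.2) * (v z.1 - v z.2) * ‖z.1 - z.2‖ ^ (-(N : ℝ) - 2 * s))
  + (∫ x, V x * u x * v x)
  - (∫ z : Sp N × Sp N, |u z.1| ^ p * |u z.2| ^ (p - 2) * u z.2 * v z.2 * ‖z.1 - z.2‖ ^ (α - (N : ℝ)))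
  - lam * (∫ z : Sp N × Sp N, |u z.1| ^ q * |u z.2| ^ (q - 2) * u z.2 * v z.2 * ‖z.1 - z.2‖ ^ (β - (N : ℝ)))

/-- `u` is nonzero as an element of a function space (not a.e. zero). -/
def nonzero (N : ℕ) (u : Sp N → ℝ) : Prop :=
  ¬ (u =ᵐ[(volume : Measure (Sp N))] 0)

/-- The Nehari manifold `N_λ = {u ∈ X \ {0} : ‖u‖² = D_{α,p}(u) + λ D_{β,q}(u)}`. -/
def NehariD (N : ℕ) (s α β p q lam : ℝ) (V : Sp N → ℝ) : Set (Sp N → ℝ) :=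
  {u | memX N s V u ∧ nonzero N u ∧ normSq N s V u = Dnl N α p u + lam * Dnl N β q u}

/-- The unperturbed energy `J(u) = ½‖u‖² - (1/(2p)) D_{α,p}(u)`. -/
noncomputable def Jfun (N : ℕ) (s α p : ℝ) (V : Sp N → ℝ) (u : Sp N → ℝ) : ℝ :=
  normSq N s V u / 2 - Dnl N α p u / (2 * p)

/-- The Nehari manifold of `J`: `N_J = {u ∈ X \ {0} : ‖u‖² = D_{α,p}(u)}`. -/
def NehJ (N : ℕ) (s α p : ℝ) (V : Sp N → ℝ) : Set (Sp N → ℝ) :=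
  {u | memX N s V u ∧ nonzero N u ∧ normSq N s V u = Dnl N α p u}


/-- The truncation used to approximate the groundstate. -/
def trunc (n : ℕ) (t : ℝ) : ℝ := min (max (|t| - 1 / ((n : ℝ) + 1)) 0) ((n : ℝ) + 1)

lemma trunc_nonneg (n : ℕ) (t : ℝ) : 0 ≤ trunc n t := by
  unfold trunc; positivity

lemma trunc_le (n : ℕ) (t : ℝ) : trunc n t ≤ |t| := by
  unfold trunc
  refine (min_le_left _ _).trans (max_le ?_ (abs_nonneg t))
  have : 0 ≤ 1 / ((n : ℝ) + 1) := by positivity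
  linarith

lemma trunc_le_nat (n : ℕ) (t : ℝ) : trunc n t ≤ (n : ℝ) + 1 := min_le_right _ _

lemma trunc_lip (n : ℕ) (a b : ℝ) : |trunc n a - trunc n b| ≤ |a - b| := by
  unfold trunc
  calc _ ≤ |max (|a| - 1 / ((n : ℝ) + 1)) 0 - max (|b| - 1 / ((n : ℝ) + 1)) 0| := by
        have := abs_min_sub_min_le_max (max (|a| - 1 / ((n : ℝ) + 1)) 0) ((n : ℝ) + 1)
          (max (|b| - 1 / ((n : ℝ) + 1)) 0) ((n : ℝ) + 1)
        simpa using this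
    _ ≤ |(|a| - 1 / ((n : ℝ) + 1)) - (|b| - 1 / ((n : ℝ) + 1))| := by
        have := abs_max_sub_max_le_max (|a| - 1 / ((n : ℝ) + 1)) 0 (|b| - 1 / ((n : ℝ) + 1)) 0
        simpa using this
    _ = |(|a| - |b|)| := by ring_nf
    _ ≤ _ := abs_abs_sub_abs_le_abs_sub a b

lemma trunc_mono {m n : ℕ} (h : m ≤ n) (t : ℝ) : trunc m t ≤ trunc n t := by
  unfold trunc
  have h' : (m : ℝ) ≤ n := by exact_mod_cast h
  gcongr

lemma trunc_tendsto (t : ℝ) : Tendsto (fun n => trunc n t) atTop (𝓝 |t|) := by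
  have h1 : Tendsto (fun n : ℕ => max (|t| - 1 / ((n : ℝ) + 1)) 0) atTop (𝓝 |t|) := by
    have := ((tendsto_const_nhds (x := |t|)).sub
      (tendsto_one_div_add_atTop_nhds_zero_nat (𝕜 := ℝ))).max (tendsto_const_nhds (x := (0 : ℝ)))
    simpa using this
  refine h1.congr' ?_
  filter_upwards [tendsto_natCast_atTop_atTop.eventually_ge_atTop (|t|)] with n hn
  unfold trunc
  rw [min_eq_left]
  have : 0 ≤ 1 / ((n : ℝ) + 1) := by positivity
  exact max_le (by linarith) (by positivity)

lemma trunc_meas (n : ℕ) : Measurable (trunc n) := by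
  unfold trunc; fun_prop

lemma trunc_pos_iff (n : ℕ) (t : ℝ) : 0 < trunc n t ↔ 1 / ((n : ℝ) + 1) < |t| := by
  unfold trunc
  have : 0 < (n : ℝ) + 1 := by positivity
  simp [this, lt_min_iff, lt_max_iff]

lemma kernel_loc (N : ℕ) (hN : 3 ≤ N) {β : ℝ} (hβ : 0 < β) :
    IntegrableOn (fun x : Sp N => ‖x‖ ^ (β - (N : ℝ))) (Metric.ball 0 1) := by
  haveI : Nonempty (Fin N) := ⟨⟨0, by omega⟩⟩
  haveI : Nontrivial (Sp N) := inferInstance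
  rw [integrableOn_fun_norm_addHaar volume (f := fun r : ℝ => r ^ (β - (N : ℝ)))]
  have : IntegrableOn (fun r : ℝ => r ^ (β - 1)) (Set.Ioo 0 1) := by
    rw [intervalIntegral.integrableOn_Ioo_rpow_iff one_pos]; linarith
  refine this.congr_fun ?_ measurableSet_Ioo
  intro r hr
  have hr0 : 0 < r := hr.1
  simp only [finrank_euclideanSpace, Fintype.card_fin, smul_eq_mul]
  rw [← Real.rpow_natCast, ← Real.rpow_add hr0, Nat.cast_sub (by omega)]
  congr 1; push_cast; ring

lemma kernel_int (N : ℕ) (hN : 3 ≤ N) {β : ℝ} (hβ : β ∈ Set.Ioo (0 : ℝ) (N : ℝ))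
    {f : Sp N → ℝ} (hf : Integrable f) (hf0 : ∀ x, 0 ≤ f x) {C : ℝ} (hC : ∀ x, f x ≤ C) :
    Integrable (fun z : Sp N × Sp N => f z.1 * f z.2 * ‖z.1 - z.2‖ ^ (β - (N : ℝ))) := by
  set K : Sp N → ℝ := (Metric.ball 0 1).indicator (fun x => ‖x‖ ^ (β - (N : ℝ))) with hK
  have hKi : Integrable K := (integrable_indicator_iff Metric.isOpen_ball.measurableSet).2
    (kernel_loc N hN hβ.1)
  have h1 : Integrable (fun z : Sp N × Sp N => f z.2 * K (z.1 - z.2)) := by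
    have := hf.convolution_integrand (ContinuousLinearMap.mul ℝ ℝ) hKi
    exact this
  have h2 : Integrable (fun z : Sp N × Sp N => f z.1 * f z.2) := hf.mul_prod hf
  refine ((h1.const_mul C).add h2).mono' ?_ ?_
  · refine h2.aestronglyMeasurable.mul ?_
    refine Measurable.aestronglyMeasurable ?_
    fun_prop
  · refine Eventually.of_forall fun z => ?_
    have hk0 : 0 ≤ ‖z.1 - z.2‖ ^ (β - (N : ℝ)) := by positivity
    rw [Real.norm_of_nonneg (mul_nonneg (mul_nonneg (hf0 _) (hf0 _)) hk0)]
    have hC0 : 0 ≤ C := (hf0 0).trans (hC 0)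
    have hff := mul_nonneg (hf0 z.1) (hf0 z.2)
    simp only [Pi.add_apply]
    by_cases hz : z.1 - z.2 ∈ Metric.ball (0 : Sp N) 1
    · rw [hK, Set.indicator_of_mem hz]
      have : f z.1 * f z.2 * ‖z.1 - z.2‖ ^ (β - (N : ℝ)) ≤
          C * f z.2 * ‖z.1 - z.2‖ ^ (β - (N : ℝ)) := by
        gcongr
        · exact hf0 _
        · exact hC _
      linarith
    · rw [hK, Set.indicator_of_notMem hz]
      have h1' : 1 ≤ ‖z.1 - z.2‖ := by simpa using hz
      have : ‖z.1 - z.2‖ ^ (β - (N : ℝ)) ≤ 1 :=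
        Real.rpow_le_one_of_one_le_of_nonpos h1' (by linarith [hβ.2])
      have := mul_le_mul_of_nonneg_left this hff
      linarith

lemma Dnl_nonneg (N : ℕ) (γ m : ℝ) (u : Sp N → ℝ) : 0 ≤ Dnl N γ m u :=
  integral_nonneg fun z => by positivity

lemma diag_null (N : ℕ) (hN : 3 ≤ N) : ∀ᵐ z : Sp N × Sp N, z.1 ≠ z.2 := by
  haveI : Nonempty (Fin N) := ⟨⟨0, by omega⟩⟩
  haveI : Nontrivial (Sp N) := inferInstance
  have hm : MeasurableSet {z : Sp N × Sp N | z.1 = z.2} :=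
    measurableSet_eq_fun measurable_fst measurable_snd
  have : volume {z : Sp N × Sp N | z.1 = z.2} = 0 := by
    rw [Measure.volume_eq_prod, Measure.measure_prod_null hm]
    refine Eventually.of_forall fun x => ?_
    have : (Prod.mk x ⁻¹' {z : Sp N × Sp N | z.1 = z.2}) = {x} := by
      ext y; simp [eq_comm]
    simp [this]
  rw [ae_iff]; simpa using this

lemma Dnl_pos (N : ℕ) (hN : 3 ≤ N) (γ m : ℝ) (u : Sp N → ℝ) (hu : nonzero N u)
    (hi : Integrable (fun z : Sp N × Sp N => |u z.1| ^ m * |u z.2| ^ m * ‖z.1 - z.2‖ ^ (γ - (N : ℝ)))) :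
    0 < Dnl N γ m u := by
  refine lt_of_le_of_ne (Dnl_nonneg _ _ _ _) fun h => ?_
  have h0 := (integral_eq_zero_iff_of_nonneg (fun z => by positivity) hi).1 h.symm
  have hS : volume {x | u x ≠ 0} ≠ 0 := fun h => hu (by
    rw [Filter.EventuallyEq, ae_iff]; simpa using h)
  have h2 : volume ({x | u x ≠ 0} ×ˢ {x | u x ≠ 0}) = 0 := by
    have : ∀ᵐ z : Sp N × Sp N, ¬ (z ∈ {x | u x ≠ 0} ×ˢ {x | u x ≠ 0}) := by
      filter_upwards [h0, diag_null N hN] with z hz hd hmem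
      have a1 : 0 < |u z.1| := abs_pos.2 hmem.1
      have a2 : 0 < |u z.2| := abs_pos.2 hmem.2
      have a3 : 0 < ‖z.1 - z.2‖ := norm_pos_iff.2 (sub_ne_zero.2 hd)
      have : 0 < |u z.1| ^ m * |u z.2| ^ m * ‖z.1 - z.2‖ ^ (γ - (N : ℝ)) := by positivity
      exact this.ne' hz
    rw [ae_iff] at this
    simpa only [not_not, Set.setOf_mem_eq] using this
  rw [Measure.volume_eq_prod, Measure.prod_prod, mul_eq_zero] at h2
  tauto

lemma Dnl_smul (N : ℕ) (γ m : ℝ) (u : Sp N → ℝ) {t : ℝ} (ht : 0 < t) :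
    Dnl N γ m (fun x => t * u x) = t ^ (2 * m) * Dnl N γ m u := by
  unfold Dnl
  rw [← integral_const_mul]
  congr 1; ext z
  rw [abs_mul, abs_mul, abs_of_pos ht, Real.mul_rpow ht.le (abs_nonneg _),
    Real.mul_rpow ht.le (abs_nonneg _), two_mul, Real.rpow_add ht]
  ring

lemma normSq_smul (N : ℕ) (s : ℝ) (V u : Sp N → ℝ) (t : ℝ) :
    normSq N s V (fun x => t * u x) = t ^ 2 * normSq N s V u := by
  unfold normSq gagSq
  rw [mul_add, ← integral_const_mul, ← integral_const_mul]
  congr 2 <;> (ext z; ring)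

lemma memX_smul (N : ℕ) (s : ℝ) (V u : Sp N → ℝ) (t : ℝ) (h : memX N s V u) :
    memX N s V (fun x => t * u x) := by
  refine ⟨h.1.const_mul t, ?_, ?_⟩
  · refine (h.2.1.const_mul (t ^ 2)).congr (Eventually.of_forall fun z => ?_)
    simp only; ring
  · refine (h.2.2.const_mul (t ^ 2)).congr (Eventually.of_forall fun z => ?_)
    simp only; ring

lemma trunc_sq (n : ℕ) (a b : ℝ) : (trunc n a - trunc n b) ^ 2 ≤ (a - b) ^ 2 :=
  sq_le_sq.2 (trunc_lip n a b)

lemma trunc_sq' (n : ℕ) (a : ℝ) : (trunc n a) ^ 2 ≤ a ^ 2 := by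
  refine sq_le_sq.2 ?_
  rw [abs_of_nonneg (trunc_nonneg n a)]
  exact trunc_le n a

lemma memX_trunc (N : ℕ) (s : ℝ) (V u : Sp N → ℝ) (hV : Continuous V) (hV0 : ∀ x, 0 ≤ V x)
    (n : ℕ) (h : memX N s V u) : memX N s V (fun x => trunc n (u x)) := by
  have hm := (trunc_meas n).comp h.1
  have hu := h.1
  have hm' : Measurable (fun x => trunc n (u x)) := hm
  refine ⟨hm, ?_, ?_⟩
  · refine h.2.1.mono' (Measurable.aestronglyMeasurable ?_) (Eventually.of_forall fun z => ?_)
    · have h1 : Measurable (fun z : Sp N × Sp N => trunc n (u z.1)) := hm'.comp measurable_fst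
      have h2 : Measurable (fun z : Sp N × Sp N => trunc n (u z.2)) := hm'.comp measurable_snd
      fun_prop
    · rw [Real.norm_of_nonneg (by positivity)]
      have := trunc_sq n (u z.1) (u z.2)
      gcongr
  · refine h.2.2.mono' (Measurable.aestronglyMeasurable ?_) (Eventually.of_forall fun x => ?_)
    · have := hV.measurable
      fun_prop
    · rw [Real.norm_of_nonneg (mul_nonneg (hV0 x) (sq_nonneg _))]
      exact mul_le_mul_of_nonneg_left (trunc_sq' n _) (hV0 x)

lemma normSq_trunc (N : ℕ) (s : ℝ) (V u : Sp N → ℝ) (hV : Continuous V) (hV0 : ∀ x, 0 ≤ V x)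
    (n : ℕ) (h : memX N s V u) : normSq N s V (fun x => trunc n (u x)) ≤ normSq N s V u := by
  have ht := memX_trunc N s V u hV hV0 n h
  unfold normSq gagSq
  refine add_le_add (integral_mono ht.2.1 h.2.1 fun z => ?_)
    (integral_mono ht.2.2 h.2.2 fun x => ?_)
  · have := trunc_sq n (u z.1) (u z.2)
    simp only
    gcongr
  · exact mul_le_mul_of_nonneg_left (trunc_sq' n _) (hV0 x)

lemma normSq_pos (N : ℕ) (s : ℝ) (V u : Sp N → ℝ) (hV0 : ∀ x, 0 < V x)
    (h : memX N s V u) (hu : nonzero N u) : 0 < normSq N s V u := by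
  have h1 : 0 ≤ gagSq N s u := integral_nonneg fun z => by positivity
  have h2 : 0 ≤ ∫ x, V x * u x ^ 2 :=
    integral_nonneg fun x => mul_nonneg (hV0 x).le (sq_nonneg _)
  have h3 : ∫ x, V x * u x ^ 2 ≠ 0 := fun h0 => hu (by
    have := (integral_eq_zero_iff_of_nonneg
      (fun x => mul_nonneg (hV0 x).le (sq_nonneg _)) h.2.2).1 h0
    filter_upwards [this] with x hx
    have : V x = 0 ∨ u x ^ 2 = 0 := mul_eq_zero.1 hx
    rcases this with h | h
    · exact absurd h (hV0 x).ne'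
    · simpa using h)
  unfold normSq
  have := lt_of_le_of_ne h2 h3.symm
  linarith

lemma trunc_rpow_int (N : ℕ) (s : ℝ) (V u : Sp N → ℝ) {V₀ : ℝ} (hV₀ : 0 < V₀)
    (hV1 : ∀ x, V₀ ≤ V x) (n : ℕ) {m : ℝ} (hm : 0 < m) (h : memX N s V u) :
    Integrable (fun x => |trunc n (u x)| ^ m) := by
  have hmeas : Measurable (fun x => trunc n (u x)) := (trunc_meas n).comp h.1
  set c : ℝ := ((n : ℝ) + 1) ^ m * (((n : ℝ) + 1) ^ 2 / V₀) with hc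
  refine (h.2.2.const_mul c).mono' (Measurable.aestronglyMeasurable (by fun_prop))
    (Eventually.of_forall fun x => ?_)
  rw [Real.norm_of_nonneg (by positivity), abs_of_nonneg (trunc_nonneg n _)]
  have hVx : 0 ≤ V x := hV₀.le.trans (hV1 x)
  by_cases hp : 0 < trunc n (u x)
  · have hu := (trunc_pos_iff n _).1 hp
    have hle : trunc n (u x) ^ m ≤ ((n : ℝ) + 1) ^ m :=
      Real.rpow_le_rpow hp.le (trunc_le_nat n _) hm.le
    have hn : 0 < (n : ℝ) + 1 := by positivity
    have h1 : 1 ≤ ((n : ℝ) + 1) * |u x| := by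
      rw [div_lt_iff₀ hn] at hu; linarith
    have h2 : 1 ≤ ((n : ℝ) + 1) ^ 2 * u x ^ 2 := by
      rw [← sq_abs (u x), ← mul_pow]; exact one_le_pow₀ h1
    have h3 : 1 ≤ V x / V₀ := (one_le_div hV₀).2 (hV1 x)
    have h4 : 1 ≤ (((n : ℝ) + 1) ^ 2 * u x ^ 2) * (V x / V₀) := one_le_mul_of_one_le_of_one_le h2 h3
    calc _ ≤ ((n : ℝ) + 1) ^ m * 1 := by simpa using hle
      _ ≤ ((n : ℝ) + 1) ^ m * ((((n : ℝ) + 1) ^ 2 * u x ^ 2) * (V x / V₀)) := by gcongr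
      _ = _ := by rw [hc]; ring
  · have : trunc n (u x) = 0 := le_antisymm (not_lt.1 hp) (trunc_nonneg n _)
    rw [this, Real.zero_rpow hm.ne']
    have : 0 ≤ c := by positivity
    exact mul_nonneg this (mul_nonneg hVx (sq_nonneg _))

lemma Dnl_trunc_int (N : ℕ) (hN : 3 ≤ N) (s : ℝ) (V u : Sp N → ℝ) {V₀ : ℝ} (hV₀ : 0 < V₀)
    (hV1 : ∀ x, V₀ ≤ V x) (n : ℕ) {m β : ℝ} (hm : 0 < m) (hβ : β ∈ Set.Ioo (0 : ℝ) (N : ℝ))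
    (h : memX N s V u) :
    Integrable (fun z : Sp N × Sp N => |trunc n (u z.1)| ^ m * |trunc n (u z.2)| ^ m
      * ‖z.1 - z.2‖ ^ (β - (N : ℝ))) := by
  refine kernel_int N hN hβ (f := fun x => |trunc n (u x)| ^ m)
    (trunc_rpow_int N s V u hV₀ hV1 n hm h) (fun x => by positivity)
    (C := ((n : ℝ) + 1) ^ m) fun x => ?_
  rw [abs_of_nonneg (trunc_nonneg n _)]
  exact Real.rpow_le_rpow (trunc_nonneg n _) (trunc_le_nat n _) hm.le

lemma Dnl_trunc_mono (N : ℕ) (hN : 3 ≤ N) (s : ℝ) (V u : Sp N → ℝ) {V₀ : ℝ} (hV₀ : 0 < V₀)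
    (hV1 : ∀ x, V₀ ≤ V x) {k n : ℕ} (hkn : k ≤ n) {m β : ℝ} (hm : 0 < m)
    (hβ : β ∈ Set.Ioo (0 : ℝ) (N : ℝ)) (h : memX N s V u) :
    Dnl N β m (fun x => trunc k (u x)) ≤ Dnl N β m (fun x => trunc n (u x)) := by
  refine integral_mono (Dnl_trunc_int N hN s V u hV₀ hV1 k hm hβ h)
    (Dnl_trunc_int N hN s V u hV₀ hV1 n hm hβ h) fun z => ?_
  have key : ∀ x, |trunc k (u x)| ^ m ≤ |trunc n (u x)| ^ m := fun x => by
    rw [abs_of_nonneg (trunc_nonneg k _), abs_of_nonneg (trunc_nonneg n _)]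
    exact Real.rpow_le_rpow (trunc_nonneg k _) (trunc_mono hkn _) hm.le
  have h1 := key z.1
  have h2 := key z.2
  simp only
  gcongr

lemma Dnl_trunc_tendsto (N : ℕ) (u : Sp N → ℝ) (hu : Measurable u) {m α : ℝ} (hm : 0 < m)
    (hi : Integrable (fun z : Sp N × Sp N => |u z.1| ^ m * |u z.2| ^ m * ‖z.1 - z.2‖ ^ (α - (N : ℝ)))) :
    Tendsto (fun n => Dnl N α m (fun x => trunc n (u x))) atTop (𝓝 (Dnl N α m u)) := by
  refine tendsto_integral_of_dominated_convergence _ (fun n => ?_) hi (fun n => ?_) ?_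
  · have hmeas : Measurable (fun x => trunc n (u x)) := (trunc_meas n).comp hu
    have h1 : Measurable (fun z : Sp N × Sp N => trunc n (u z.1)) := hmeas.comp measurable_fst
    have h2 : Measurable (fun z : Sp N × Sp N => trunc n (u z.2)) := hmeas.comp measurable_snd
    exact Measurable.aestronglyMeasurable (by fun_prop)
  · refine Eventually.of_forall fun z => ?_
    rw [Real.norm_of_nonneg (by positivity)]
    have key : ∀ x, |trunc n (u x)| ^ m ≤ |u x| ^ m := fun x => by
      rw [abs_of_nonneg (trunc_nonneg n _)]
      exact Real.rpow_le_rpow (trunc_nonneg n _) (trunc_le n _) hm.le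
    have h1 := key z.1
    have h2 := key z.2
    gcongr
  · refine Eventually.of_forall fun z => ?_
    have key : ∀ x, Tendsto (fun n => |trunc n (u x)| ^ m) atTop (𝓝 (|u x| ^ m)) := fun x => by
      have := (trunc_tendsto (u x)).abs
      rw [abs_abs] at this
      exact this.rpow_const (Or.inr hm.le)
    exact ((key z.1).mul (key z.2)).mul_const _

lemma trunc_nonzero (N : ℕ) (u : Sp N → ℝ) (hu : nonzero N u) :
    ∃ n, nonzero N (fun x => trunc n (u x)) := by
  by_contra hcon
  push Not at hcon
  unfold nonzero at hcon hu
  simp only [not_not] at hcon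
  apply hu
  have := ae_all_iff.2 hcon
  filter_upwards [this] with x hx
  have h1 := trunc_tendsto (u x)
  have h2 : (fun n => trunc n (u x)) = fun _ => 0 := funext hx
  rw [h2] at h1
  have := tendsto_nhds_unique h1 tendsto_const_nhds
  simpa using this

/-- `m_λ < m_J`, provided `m_J` is attained. -/
theorem m_lam_lt_m_J
    (N : ℕ) (s α β p q lam : ℝ) (V : Sp N → ℝ)
    (hN : 3 ≤ N) (hs : s ∈ Set.Ioo (0 : ℝ) 1)
    (hα : α ∈ Set.Ioo (0 : ℝ) (N : ℝ)) (hβ : β ∈ Set.Ioo (0 : ℝ) (N : ℝ))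
    (hV : Continuous V) (hV1 : ∃ V₀ > 0, ∀ x, V₀ ≤ V x)
    (hq1 : 1 < q) (hpq : q < p) (hlam : 0 < lam)
    (hpl : ((N : ℝ) + α) / N < p) (hpu : p < ((N : ℝ) + α) / ((N : ℝ) - 2 * s))
    (hql : ((N : ℝ) + β) / N < q) (hqu : q < ((N : ℝ) + β) / ((N : ℝ) - 2 * s))
    (hQ : ∃ Q ∈ NehJ N s α p V, Jfun N s α p V Q = sInf (Jfun N s α p V '' NehJ N s α p V)) :
    sInf (energy N s α β p q lam V '' NehariD N s α β p q lam V)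
      < sInf (Jfun N s α p V '' NehJ N s α p V) := by
  obtain ⟨V₀, hV₀, hV1⟩ := hV1
  obtain ⟨Q, ⟨hQX, hQ0, hQN⟩, hQm⟩ := hQ
  have hVp : ∀ x, 0 < V x := fun x => hV₀.trans_le (hV1 x)
  have hq0 : 0 < q := by linarith
  have hp0 : 0 < p := by linarith
  rw [← hQm]
  set A := normSq N s V Q with hA
  have hApos : 0 < A := normSq_pos N s V Q hVp hQX hQ0
  have hDi : Integrable (fun z : Sp N × Sp N =>
      |Q z.1| ^ p * |Q z.2| ^ p * ‖z.1 - z.2‖ ^ (α - (N : ℝ))) := by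
    by_contra hni
    have : Dnl N α p Q = 0 := integral_undef hni
    rw [this] at hQN
    linarith
  have hlim := Dnl_trunc_tendsto N Q hQX.1 hp0 hDi
  rw [← hQN] at hlim
  obtain ⟨k, hk⟩ := trunc_nonzero N Q hQ0
  have hB0 : 0 < Dnl N β q (fun x => trunc k (Q x)) :=
    Dnl_pos N hN β q _ hk (Dnl_trunc_int N hN s V Q hV₀ hV1 k hq0 hβ hQX)
  set B0 := Dnl N β q (fun x => trunc k (Q x)) with hB0def
  have hlB : 0 < lam * B0 := mul_pos hlam hB0
  obtain ⟨n, hn, hkn⟩ := ((hlim.eventually (lt_mem_nhds (show A - lam * B0 < A by linarith))).and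
    (eventually_ge_atTop k)).exists
  have hBn := Dnl_trunc_mono N hN s V Q hV₀ hV1 hkn hq0 hβ hQX
  rw [← hB0def] at hBn
  have hun : nonzero N (fun x => trunc n (Q x)) := fun h0 => hk (by
    filter_upwards [h0] with x hx
    have h1 := trunc_mono hkn (Q x)
    have h2 := trunc_nonneg k (Q x)
    simp only [Pi.zero_apply] at hx ⊢
    linarith)
  have huX := memX_trunc N s V Q hV (fun x => (hVp x).le) n hQX
  have haA := normSq_trunc N s V Q hV (fun x => (hVp x).le) n hQX
  have hapos := normSq_pos N s V _ hVp huX hun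
  set u : Sp N → ℝ := fun x => trunc n (Q x) with hu
  set a := normSq N s V u with ha
  set D := Dnl N α p u with hD
  set B := Dnl N β q u with hB
  have hD0 : 0 ≤ D := Dnl_nonneg _ _ _ _
  have hlBn : lam * B0 ≤ lam * B := mul_le_mul_of_nonneg_left hBn hlam.le
  -- the intermediate value theorem on [0,1]
  have hcont : ContinuousOn (fun t : ℝ => t ^ (2 * p - 2) * D + lam * (t ^ (2 * q - 2) * B))
      (Set.Icc 0 1) := by
    have c1 : Continuous (fun t : ℝ => t ^ (2 * p - 2)) :=
      continuous_id.rpow_const fun _ => Or.inr (by linarith)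
    have c2 : Continuous (fun t : ℝ => t ^ (2 * q - 2)) :=
      continuous_id.rpow_const fun _ => Or.inr (by linarith)
    exact Continuous.continuousOn (by fun_prop)
  have hivt := intermediate_value_Ioo (zero_le_one' ℝ) hcont
  obtain ⟨t, ⟨ht0, ht1⟩, hta⟩ := hivt (show a ∈ Set.Ioo _ _ by
    simp only [Real.one_rpow, one_mul]
    rw [Real.zero_rpow (by linarith), Real.zero_rpow (by linarith)]
    constructor
    · simpa using hapos
    · linarith)
  simp only at hta
  have hrp : ∀ r : ℝ, t ^ (2 * r) = t ^ 2 * t ^ (2 * r - 2) := fun r => by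
    rw [← Real.rpow_natCast t 2, ← Real.rpow_add ht0]
    congr 1; push_cast; ring
  have hneh : t ^ 2 * a = t ^ (2 * p) * D + lam * (t ^ (2 * q) * B) := by
    rw [hrp p, hrp q, ← hta]; ring
  have hmem : (fun x => t * u x) ∈ NehariD N s α β p q lam V := by
    refine ⟨memX_smul N s V u t huX, fun h0 => hun ?_, ?_⟩
    · filter_upwards [h0] with x hx
      have hx' : t * u x = 0 := hx
      exact (mul_eq_zero.1 hx').resolve_left ht0.ne'
    · rw [normSq_smul, Dnl_smul _ _ _ _ ht0, Dnl_smul _ _ _ _ ht0]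
      exact hneh
  have hbdd : BddBelow (energy N s α β p q lam V '' NehariD N s α β p q lam V) := by
    refine ⟨0, ?_⟩
    rintro _ ⟨w, ⟨_, _, hw⟩, rfl⟩
    unfold energy
    rw [hw]
    have d1 := Dnl_nonneg N α p w
    have d2 := mul_nonneg hlam.le (Dnl_nonneg N β q w)
    have e1 : Dnl N α p w / (2 * p) ≤ Dnl N α p w / 2 :=
      div_le_div_of_nonneg_left d1 two_pos (by linarith)
    have e2 : lam * Dnl N β q w / (2 * q) ≤ lam * Dnl N β q w / 2 :=
      div_le_div_of_nonneg_left d2 two_pos (by linarith)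
    linarith
  refine (csInf_le hbdd ⟨_, hmem, rfl⟩).trans_lt ?_
  unfold energy Jfun
  rw [← hQN, ← hA, normSq_smul, Dnl_smul _ _ _ _ ht0, Dnl_smul _ _ _ _ ht0, ← ha, ← hD, ← hB]
  have hBpos : 0 ≤ lam * (t ^ (2 * q) * B) := by
    have := Dnl_nonneg N β q u
    positivity
  have e1 : lam * (t ^ (2 * q) * B) / (2 * p) ≤ lam * (t ^ (2 * q) * B) / (2 * q) :=
    div_le_div_of_nonneg_left hBpos (by linarith) (by linarith)
  have e2 : t ^ 2 * a / (2 * p) = t ^ (2 * p) * D / (2 * p)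
      + lam * (t ^ (2 * q) * B) / (2 * p) := by rw [hneh]; ring
  have e3 : t ^ 2 * a < A := by
    have : t ^ 2 < 1 := by nlinarith
    nlinarith
  have e4 : 0 < 1 / 2 - 1 / (2 * p) := by
    have : 1 / (2 * p) < 1 / 2 := one_div_lt_one_div_of_lt two_pos (by linarith)
    linarith
  have e5 := mul_lt_mul_of_pos_right e3 e4
  have e6 : t ^ 2 * a * (1 / 2 - 1 / (2 * p)) = t ^ 2 * a / 2 - t ^ 2 * a / (2 * p) := by ring
  have e7 : A * (1 / 2 - 1 / (2 * p)) = A / 2 - A / (2 * p) := by ring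
  linarith
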